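/- Suppose d ≡ 0 (mod 4). Then there exist two ℤ-submodules S'_1 and S'_2 of the ℚ-span of S, each containing S with index 2, each even (⟨u,v⟩ ∈ ℤ for all u,v and ⟨u,u⟩ ∈ 2ℤ for all u in the submodule), each satisfying S'_i ∩ (ℚ-span of Ω) = Ω and S'_i ∩ ℚℓ = ℤℓ, such that S'_1 and S'_2 are not isometric: there is no ℤ-linear bijection S'_1 → S'_2 preserving the bilinear form. -/

import Mathlib

/- Context: V ⊕ ℚℓ = ℚ^23 (ℓ = coordinate 22) with the Gram matrix of the
paper extended by ⟨ℓ,ℓ⟩ = 2d, Ω = Ω_{2,2} the co-invariant lattice, and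
S = Ω + ℤℓ. -/

noncomputable section
open Matrix

abbrev V : Type := Fin 23 → ℚ

/-- Gram matrix of V ⊕ ℚℓ, depending on d. -/
def gramX (d : ℤ) : Matrix (Fin 23) (Fin 23) ℚ := Matrix.of fun i j =>
  if i.val = 22 ∨ j.val = 22 then (if i = j then 2 * (d : ℚ) else 0)
  else if i = j then
    (if i.val < 16 then -2 else if i.val < 18 then -4 else if i.val < 20 then 0 else 4)
  else if i.val / 2 = j.val / 2 then
    (if i.val < 16 then 1 else if i.val < 18 then 2 else if i.val < 20 then 3 else 2)
  else 0

def B (d : ℤ) (u v : V) : ℚ := u ⬝ᵥ (gramX d *ᵥ v)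

def bv : Fin 23 → V := fun i j => if i = j then 1 else 0

def ΩGens : Set V :=
  {bv 16, bv 17,
   bv 10 - bv 8, bv 11 - bv 9, bv 14 - bv 12, bv 15 - bv 13,
   bv 2 - bv 0, bv 0 - bv 4, bv 4 - bv 6, bv 1 - bv 3, bv 5 - bv 1, bv 7 - bv 5,
   (1/3 : ℚ) • (bv 0 - bv 2 - bv 4 + bv 6 - bv 1 + bv 3 + bv 5 - bv 7 + bv 16 - bv 17),
   (1/3 : ℚ) • (-(bv 0) + bv 6 + bv 1 - bv 7 - bv 8 + bv 10 + bv 9 - bv 11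
      - bv 12 + bv 14 + bv 13 - bv 15),
   (1/3 : ℚ) • (bv 0 + bv 2 - bv 4 - bv 6 - bv 1 - bv 3 + bv 5 + bv 7
      - bv 8 + bv 10 + bv 9 - bv 11)}

def Ω : Submodule ℤ V := Submodule.span ℤ ΩGens

/-- the polarization class ℓ with ℓ² = 2d -/
def ℓv : V := bv 22

/-- S = Ω ⊕ ℤℓ -/
def S : Submodule ℤ V := Ω ⊔ Submodule.span ℤ {ℓv}

/-- S' is an admissible overlattice of S: an even overlattice of S inside the
ℚ-span of S, with S' ∩ (ℚ-span of Ω) = Ω and S' ∩ ℚℓ = ℤℓ. -/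
def IsAdmissible (d : ℤ) (S' : Submodule ℤ V) : Prop :=
  S ≤ S' ∧
  S' ≤ (Submodule.span ℚ (S : Set V)).restrictScalars ℤ ∧
  (∀ u ∈ S', ∀ v ∈ S', ∃ n : ℤ, B d u v = (n : ℚ)) ∧
  (∀ u ∈ S', ∃ n : ℤ, B d u u = 2 * (n : ℚ)) ∧
  S' ⊓ (Submodule.span ℚ (Ω : Set V)).restrictScalars ℤ = Ω ∧
  S' ⊓ (Submodule.span ℚ {ℓv}).restrictScalars ℤ = Submodule.span ℤ {ℓv}

/-- the index [S' : S] -/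
def idx (S' : Submodule ℤ V) : ℕ :=
  Nat.card (↥S' ⧸ Submodule.comap S'.subtype S)

/-- Three times the generators of `Ω`, in integer coordinates. -/
def tripleGen : Fin 15 → Fin 23 → ℤ :=
  ![
    ![0, 0, 0, 0, 0, 0, 0, 0, 0, 0, 0, 0, 0, 0, 0, 0, 3, 0, 0, 0, 0, 0, 0],
    ![0, 0, 0, 0, 0, 0, 0, 0, 0, 0, 0, 0, 0, 0, 0, 0, 0, 3, 0, 0, 0, 0, 0],
    ![0, 0, 0, 0, 0, 0, 0, 0, -3, 0, 3, 0, 0, 0, 0, 0, 0, 0, 0, 0, 0, 0, 0],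
    ![0, 0, 0, 0, 0, 0, 0, 0, 0, -3, 0, 3, 0, 0, 0, 0, 0, 0, 0, 0, 0, 0, 0],
    ![0, 0, 0, 0, 0, 0, 0, 0, 0, 0, 0, 0, -3, 0, 3, 0, 0, 0, 0, 0, 0, 0, 0],
    ![0, 0, 0, 0, 0, 0, 0, 0, 0, 0, 0, 0, 0, -3, 0, 3, 0, 0, 0, 0, 0, 0, 0],
    ![-3, 0, 3, 0, 0, 0, 0, 0, 0, 0, 0, 0, 0, 0, 0, 0, 0, 0, 0, 0, 0, 0, 0],
    ![3, 0, 0, 0, -3, 0, 0, 0, 0, 0, 0, 0, 0, 0, 0, 0, 0, 0, 0, 0, 0, 0, 0],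
    ![0, 0, 0, 0, 3, 0, -3, 0, 0, 0, 0, 0, 0, 0, 0, 0, 0, 0, 0, 0, 0, 0, 0],
    ![0, 3, 0, -3, 0, 0, 0, 0, 0, 0, 0, 0, 0, 0, 0, 0, 0, 0, 0, 0, 0, 0, 0],
    ![0, -3, 0, 0, 0, 3, 0, 0, 0, 0, 0, 0, 0, 0, 0, 0, 0, 0, 0, 0, 0, 0, 0],
    ![0, 0, 0, 0, 0, -3, 0, 3, 0, 0, 0, 0, 0, 0, 0, 0, 0, 0, 0, 0, 0, 0, 0],
    ![1, -1, -1, 1, -1, 1, 1, -1, 0, 0, 0, 0, 0, 0, 0, 0, 1, -1, 0, 0, 0, 0, 0],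
    ![-1, 1, 0, 0, 0, 0, 1, -1, -1, 1, 1, -1, -1, 1, 1, -1, 0, 0, 0, 0, 0, 0, 0],
    ![1, -1, 1, -1, -1, 1, -1, 1, -1, 1, 1, -1, 0, 0, 0, 0, 0, 0, 0, 0, 0, 0, 0]]

/-- The generators of `Ω`. -/
def gen (k : Fin 15) : V := fun i => (tripleGen k i : ℚ) / 3

/-- The Gram matrix of the generators of `Ω`. -/
def genGram : Matrix (Fin 15) (Fin 15) ℤ :=
  !![
    -4, 2, 0, 0, 0, 0, 0, 0, 0, 0, 0, 0, -2, 0, 0;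
    2, -4, 0, 0, 0, 0, 0, 0, 0, 0, 0, 0, 2, 0, 0;
    0, 0, -4, 2, 0, 0, 0, 0, 0, 0, 0, 0, 0, -2, -2;
    0, 0, 2, -4, 0, 0, 0, 0, 0, 0, 0, 0, 0, 2, 2;
    0, 0, 0, 0, -4, 2, 0, 0, 0, 0, 0, 0, 0, -2, 0;
    0, 0, 0, 0, 2, -4, 0, 0, 0, 0, 0, 0, 0, 2, 0;
    0, 0, 0, 0, 0, 0, -4, 2, 0, -2, 1, 0, 2, -1, 0;
    0, 0, 0, 0, 0, 0, 2, -4, 2, 1, -2, 1, -2, 1, -2;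
    0, 0, 0, 0, 0, 0, 0, 2, -4, 0, 1, -2, 2, 1, 0;
    0, 0, 0, 0, 0, 0, -2, 1, 0, -4, 2, 0, 2, -1, 0;
    0, 0, 0, 0, 0, 0, 1, -2, 1, 2, -4, 2, -2, 1, -2;
    0, 0, 0, 0, 0, 0, 0, 1, -2, 0, 2, -4, 2, 1, 0;
    -2, 2, 0, 0, 0, 0, 2, -2, 2, 2, -2, 2, -4, 0, 0;
    0, 0, -2, 2, -2, 2, -1, 1, 1, -1, 1, 1, 0, -4, 0;
    0, 0, -2, 2, 0, 0, 0, -2, 0, 0, -2, 0, 0, 0, -4]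

/-- Integral combinations of the generators of `Ω`. -/
def comb : (Fin 15 → ℤ) →ₗ[ℤ] V := Fintype.linearCombination ℤ gen

/-- The form `B d` as a bilinear form. -/
def bil (d : ℤ) : LinearMap.BilinForm ℚ V := Matrix.toBilin' (gramX d)

theorem B_eq_bil (d : ℤ) (u v : V) : B d u v = bil d u v :=
  (Matrix.toBilin'_apply' (gramX d) u v).symm

theorem ΩGens_eq_range : ΩGens = Set.range gen := by
  have h : gen = ![bv 16, bv 17,
      bv 10 - bv 8, bv 11 - bv 9, bv 14 - bv 12, bv 15 - bv 13,
      bv 2 - bv 0, bv 0 - bv 4, bv 4 - bv 6, bv 1 - bv 3, bv 5 - bv 1, bv 7 - bv 5,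
      (1/3 : ℚ) • (bv 0 - bv 2 - bv 4 + bv 6 - bv 1 + bv 3 + bv 5 - bv 7 + bv 16 - bv 17),
      (1/3 : ℚ) • (-(bv 0) + bv 6 + bv 1 - bv 7 - bv 8 + bv 10 + bv 9 - bv 11
        - bv 12 + bv 14 + bv 13 - bv 15),
      (1/3 : ℚ) • (bv 0 + bv 2 - bv 4 - bv 6 - bv 1 - bv 3 + bv 5 + bv 7
        - bv 8 + bv 10 + bv 9 - bv 11)] := by
    decide +kernel
  rw [h]
  simp only [Matrix.range_cons, Matrix.range_empty, Set.union_empty, Set.singleton_union]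
  rfl

theorem mem_Ω {x : V} : x ∈ Ω ↔ ∃ c, comb c = x := by
  rw [Ω, ΩGens_eq_range, ← Fintype.range_linearCombination]
  rfl

theorem comb_mem (c : Fin 15 → ℤ) : comb c ∈ Ω := mem_Ω.2 ⟨c, rfl⟩

theorem gramX_eq (d : ℤ) (i j : Fin 23) :
    gramX d i j = gramX 0 i j + if i = 22 ∧ j = 22 then 2 * (d : ℚ) else 0 := by
  by_cases hi : i = 22
  · by_cases hj : j = 22
    · simp [gramX, hi, hj]
    · simp [gramX, hi, hj, Ne.symm hj]
  · have : ¬ i.val = 22 := fun h => hi (Fin.ext h)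
    by_cases hj : j = 22
    · simp [gramX, hi, hj]
    · have : ¬ j.val = 22 := fun h => hj (Fin.ext h)
      simp [gramX, *]

theorem gen_apply_last (k : Fin 15) : gen k 22 = 0 := by
  have h : ∀ k, tripleGen k 22 = 0 := by decide
  simp [gen, h k]

theorem bil_gen (d : ℤ) (i j : Fin 15) : bil d (gen i) (gen j) = genGram i j := by
  have h0 : ∀ i j, gen i ⬝ᵥ (gramX 0 *ᵥ gen j) = genGram i j := by decide +kernel
  rw [← B_eq_bil, ← h0, B]
  congr 1
  funext k
  simp only [mulVec, dotProduct]
  refine Finset.sum_congr rfl fun l _ => ?_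
  rw [gramX_eq]
  by_cases hl : l = 22
  · simp [hl, gen_apply_last]
  · simp [hl]

theorem bil_comb (d : ℤ) (c c' : Fin 15 → ℤ) :
    bil d (comb c) (comb c') = ((c ⬝ᵥ (genGram *ᵥ c') : ℤ) : ℚ) := by
  simp only [comb, Fintype.linearCombination_apply, map_sum, map_zsmul, LinearMap.sum_apply,
    LinearMap.smul_apply, bil_gen, dotProduct, mulVec]
  push_cast
  simp only [Finset.mul_sum, zsmul_eq_mul (_ : ℚ)]
  rw [Finset.sum_comm]
  refine Finset.sum_congr rfl fun i _ => Finset.sum_congr rfl fun j _ => ?_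
  ring

theorem bil_symm (d : ℤ) (u v : V) : bil d u v = bil d v u := by
  have h : (gramX d)ᵀ = gramX d := by
    ext i j
    have h0 : (gramX 0)ᵀ = gramX 0 := by decide +kernel
    have h1 : gramX 0 j i = gramX 0 i j := congrFun (congrFun h0 i) j
    rw [transpose_apply, gramX_eq d j i, gramX_eq d i j, h1]
    simp only [and_comm]
  rw [← B_eq_bil, ← B_eq_bil, B, B, dotProduct_mulVec, dotProduct_comm, ← mulVec_transpose, h]

theorem bil_ℓv (d : ℤ) (v : V) : bil d ℓv v = 2 * d * v 22 := by
  have h : ∀ j, gramX d 22 j = if j = 22 then 2 * (d : ℚ) else 0 := by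
    intro j
    simp [gramX, eq_comm]
  have hℓ : ℓv = Pi.single 22 1 := by
    funext i
    simp [ℓv, bv, Pi.single_apply, eq_comm]
  rw [← B_eq_bil, B, hℓ, single_one_dotProduct]
  simp [mulVec, dotProduct, h]

theorem ℓv_apply_last : ℓv 22 = 1 := by simp [ℓv, bv]

theorem ℓv_apply_of_ne {i : Fin 23} (hi : i ≠ 22) : ℓv i = 0 := by
  simp [ℓv, bv, hi.symm]

theorem three_mul_comb_apply (c : Fin 15 → ℤ) (i : Fin 23) :
    3 * comb c i = ((∑ k, c k * tripleGen k i : ℤ) : ℚ) := by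
  simp only [comb, Fintype.linearCombination_apply, Finset.sum_apply, Pi.smul_apply, gen,
    Finset.mul_sum, zsmul_eq_mul (_ : ℚ)]
  push_cast
  exact Finset.sum_congr rfl fun k _ => by ring

theorem span_Ω_apply_last {x : V} (hx : x ∈ Submodule.span ℚ (Ω : Set V)) : x 22 = 0 := by
  have h : Submodule.span ℚ (Ω : Set V) ≤ LinearMap.ker (LinearMap.proj (R := ℚ) 22) := by
    rw [Submodule.span_le]
    intro y hy
    obtain ⟨c, rfl⟩ := mem_Ω.1 hy
    simp [comb, Fintype.linearCombination_apply, gen_apply_last]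
  exact h hx

theorem Ω_apply_last {x : V} (hx : x ∈ Ω) : x 22 = 0 :=
  span_Ω_apply_last (Submodule.subset_span hx)

theorem bil_Ω_ℓv (d : ℤ) {x : V} (hx : x ∈ Ω) : bil d x ℓv = 0 := by
  rw [bil_symm, bil_ℓv, Ω_apply_last hx, mul_zero]

theorem exists_bil_eq (d : ℤ) {x y : V} (hx : x ∈ Ω) (hy : y ∈ Ω) :
    ∃ n : ℤ, bil d x y = n := by
  obtain ⟨c, rfl⟩ := mem_Ω.1 hx
  obtain ⟨c', rfl⟩ := mem_Ω.1 hy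
  exact ⟨_, bil_comb d c c'⟩

theorem exists_bil_self_eq (d : ℤ) {x : V} (hx : x ∈ Ω) : ∃ n : ℤ, bil d x x = 2 * n := by
  have hdiag : ∀ k, genGram k k = 2 * (genGram k k / 2) := by decide
  rw [Ω, ΩGens_eq_range] at hx
  induction hx using Submodule.span_induction with
  | mem x h =>
    obtain ⟨k, rfl⟩ := h
    refine ⟨genGram k k / 2, ?_⟩
    rw [bil_gen]
    exact_mod_cast hdiag k
  | zero => exact ⟨0, by simp⟩
  | add x y hx hy ihx ihy =>
    rw [← ΩGens_eq_range] at hx hy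
    obtain ⟨a, ha⟩ := ihx
    obtain ⟨b, hb⟩ := ihy
    obtain ⟨n, hn⟩ := exists_bil_eq d hx hy
    refine ⟨a + b + n, ?_⟩
    simp only [map_add, LinearMap.add_apply, ha, hb, hn, bil_symm d y x]
    push_cast
    ring
  | smul m x hx ih =>
    obtain ⟨a, ha⟩ := ih
    refine ⟨m * m * a, ?_⟩
    simp only [map_zsmul, LinearMap.smul_apply, ha, zsmul_eq_mul (_ : ℚ)]
    push_cast
    ring

theorem mem_S {x : V} : x ∈ S ↔ ∃ ω ∈ Ω, ∃ n : ℤ, ω + n • ℓv = x := by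
  simp only [S, Submodule.mem_sup, Submodule.mem_span_singleton, exists_exists_eq_and]

/-- The glue vector `(u + ℓ) / 2`. -/
def glue (u : V) : V := (1 / 2 : ℚ) • (u + ℓv)

/-- The lattice generated by `Ω` and `(u + ℓ) / 2`. -/
def overlattice (u : V) : Submodule ℤ V := Ω ⊔ Submodule.span ℤ {glue u}

theorem mem_overlattice {u x : V} : x ∈ overlattice u ↔ ∃ ω ∈ Ω, ∃ n : ℤ, ω + n • glue u = x := by
  simp only [overlattice, Submodule.mem_sup, Submodule.mem_span_singleton, exists_exists_eq_and]

theorem Ω_le_overlatticelattice (u : V) : Ω ≤ overlattice u := le_sup_left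

theorem glue_mem_overlattice (u : V) : glue u ∈ overlattice u :=
  Submodule.mem_sup_right (Submodule.mem_span_singleton_self _)

theorem two_zsmul_glue (u : V) : (2 : ℤ) • glue u = u + ℓv := by
  funext i
  simp [glue]

theorem add_zsmul_glue_apply_last {u ω : V} (hu : u ∈ Ω) (hω : ω ∈ Ω) (n : ℤ) :
    (ω + n • glue u) 22 = n / 2 := by
  simp only [glue, Pi.add_apply, Pi.smul_apply, Ω_apply_last hu, Ω_apply_last hω, ℓv_apply_last,
    zsmul_eq_mul (_ : ℚ), smul_eq_mul]
  ring

theorem S_le_overlattice {u : V} (hu : u ∈ Ω) : S ≤ overlattice u := by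
  refine sup_le (Ω_le_overlatticelattice u) ?_
  rw [Submodule.span_singleton_le_iff_mem]
  have h := (overlattice u).sub_mem ((overlattice u).smul_mem 2 (glue_mem_overlattice u)) (Ω_le_overlatticelattice u hu)
  rwa [two_zsmul_glue, add_sub_cancel_left] at h

theorem add_zsmul_glue_mem_S_iff {u ω : V} (hu : u ∈ Ω) (hω : ω ∈ Ω) (n : ℤ) :
    ω + n • glue u ∈ S ↔ Even n := by
  constructor
  · intro h
    obtain ⟨ω', hω', m, hm⟩ := mem_S.1 h
    have h22 := congrFun hm 22
    rw [add_zsmul_glue_apply_last hu hω] at h22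
    simp only [Pi.add_apply, Pi.smul_apply, Ω_apply_last hω', ℓv_apply_last, zsmul_eq_mul (_ : ℚ),
      zero_add, mul_one] at h22
    refine ⟨m, ?_⟩
    have : (n : ℚ) = m + m := by linarith
    exact_mod_cast this
  · rintro ⟨m, rfl⟩
    refine mem_S.2 ⟨ω + m • u, Ω.add_mem hω (Ω.smul_mem m hu), m, ?_⟩
    rw [← two_mul, mul_comm, mul_smul, two_zsmul_glue, smul_add, add_assoc]

theorem idx_overlattice {u : V} (hu : u ∈ Ω) : idx (overlattice u) = 2 := by
  change ((S.comap (overlattice u).subtype).toAddSubgroup).index = 2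
  rw [AddSubgroup.index_eq_two_iff]
  refine ⟨⟨glue u, glue_mem_overlattice u⟩, ?_⟩
  rintro ⟨x, hx⟩
  obtain ⟨ω, hω, n, rfl⟩ := mem_overlattice.1 hx
  change Xor (ω + n • glue u + glue u ∈ S) (ω + n • glue u ∈ S)
  rw [add_assoc, ← add_one_zsmul, add_zsmul_glue_mem_S_iff hu hω, add_zsmul_glue_mem_S_iff hu hω]
  rcases Int.even_or_odd n with h | h
  · exact Or.inr ⟨h, by simpa using h.add_one⟩
  · exact Or.inl ⟨h.add_one, by simpa using h⟩

theorem bil_add_zsmul_glue (d : ℤ) {u ω ω' : V} (hu : u ∈ Ω) (hω : ω ∈ Ω) (hω' : ω' ∈ Ω)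
    (n m : ℤ) :
    bil d (ω + n • glue u) (ω' + m • glue u) = bil d ω ω' + m * (bil d u ω / 2)
      + n * (bil d u ω' / 2) + n * m * ((bil d u u + 2 * d) / 4) := by
  simp only [glue, map_add, map_zsmul, map_smul, LinearMap.add_apply, LinearMap.smul_apply,
    zsmul_eq_mul (_ : ℚ), smul_eq_mul, bil_Ω_ℓv d hu, bil_Ω_ℓv d hω, bil_symm d ℓv u, bil_symm d ℓv ω', bil_Ω_ℓv d hω',
    bil_symm d ω u, smul_add]
  rw [bil_ℓv, ℓv_apply_last]
  ring

theorem isAdmissible_overlattice {d : ℤ} (h4 : 4 ∣ d) {u : V} (hu : u ∈ Ω)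
    (h2 : ∀ ω ∈ Ω, ∃ n : ℤ, bil d u ω = 2 * n) (h8 : ∃ n : ℤ, bil d u u = 8 * n)
    (hhalf : (1 / 2 : ℚ) • u ∉ Ω) : IsAdmissible d (overlattice u) := by
  obtain ⟨e, rfl⟩ := h4
  obtain ⟨q, hq⟩ := h8
  refine ⟨S_le_overlattice hu, ?_, ?_, ?_, ?_, ?_⟩
  · intro x hx
    obtain ⟨ω, hω, n, rfl⟩ := mem_overlattice.1 hx
    have hΩ : ∀ y ∈ Ω, y ∈ Submodule.span ℚ (S : Set V) := fun y hy =>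
      Submodule.subset_span (Submodule.mem_sup_left hy)
    have hℓ : ℓv ∈ Submodule.span ℚ (S : Set V) :=
      Submodule.subset_span (Submodule.mem_sup_right (Submodule.mem_span_singleton_self _))
    exact Submodule.add_mem _ (hΩ ω hω)
      (zsmul_mem (Submodule.smul_mem _ _ (Submodule.add_mem _ (hΩ u hu) hℓ)) n)
  · intro x hx y hy
    obtain ⟨ω, hω, n, rfl⟩ := mem_overlattice.1 hx
    obtain ⟨ω', hω', m, rfl⟩ := mem_overlattice.1 hy
    obtain ⟨a, ha⟩ := exists_bil_eq (4 * e) hω hω'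
    obtain ⟨b, hb⟩ := h2 ω hω
    obtain ⟨b', hb'⟩ := h2 ω' hω'
    refine ⟨a + m * b + n * b' + n * m * (2 * q + 2 * e), ?_⟩
    rw [B_eq_bil, bil_add_zsmul_glue _ hu hω hω', ha, hb, hb', hq]
    push_cast
    ring
  · intro x hx
    obtain ⟨ω, hω, n, rfl⟩ := mem_overlattice.1 hx
    obtain ⟨a, ha⟩ := exists_bil_self_eq (4 * e) hω
    obtain ⟨b, hb⟩ := h2 ω hω
    refine ⟨a + n * b + n * n * (q + e), ?_⟩
    rw [B_eq_bil, bil_add_zsmul_glue _ hu hω hω, ha, hb, hq]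
    push_cast
    ring
  · refine le_antisymm ?_ (le_inf (Ω_le_overlatticelattice u) fun x hx => Submodule.subset_span hx)
    rintro x ⟨hx, hx'⟩
    obtain ⟨ω, hω, n, rfl⟩ := mem_overlattice.1 hx
    have h22 := span_Ω_apply_last hx'
    rw [add_zsmul_glue_apply_last hu hω] at h22
    have hn : n = 0 := by
      have : (n : ℚ) = 0 := by linarith
      exact_mod_cast this
    simpa [hn] using hω
  · refine le_antisymm ?_ ?_
    · rintro x ⟨hx, hx'⟩
      obtain ⟨ω, hω, n, rfl⟩ := mem_overlattice.1 hx
      obtain ⟨q, hq⟩ := Submodule.mem_span_singleton.1 hx'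
      have hzero : ω + ((n : ℚ) / 2) • u = 0 := by
        funext i
        by_cases hi : i = 22
        · simp [hi, Ω_apply_last hω, Ω_apply_last hu]
        · have := congrFun hq i
          simp only [Pi.smul_apply, Pi.add_apply, glue, ℓv_apply_of_ne hi, zsmul_eq_mul (_ : ℚ),
            smul_eq_mul, Pi.zero_apply] at this ⊢
          linarith
      rcases Int.even_or_odd' n with ⟨m, rfl | rfl⟩
      · refine Submodule.mem_span_singleton.2 ⟨m, ?_⟩
        rw [mul_comm, mul_smul, two_zsmul_glue]
        funext i
        have := congrFun hzero i
        simp only [Pi.smul_apply, Pi.add_apply, zsmul_eq_mul (_ : ℚ), smul_eq_mul, Pi.zero_apply] at this ⊢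
        push_cast at this
        linarith
      · refine absurd ?_ hhalf
        have : (1 / 2 : ℚ) • u = -(ω + m • u) := by
          funext i
          have := congrFun hzero i
          simp only [Pi.smul_apply, Pi.add_apply, Pi.neg_apply, zsmul_eq_mul (_ : ℚ), smul_eq_mul,
            Pi.zero_apply] at this ⊢
          push_cast at this
          linarith
        rw [this]
        exact Ω.neg_mem (Ω.add_mem hω (Ω.smul_mem m hu))
    · rw [Submodule.span_singleton_le_iff_mem]
      exact ⟨S_le_overlattice hu (Submodule.mem_sup_right (Submodule.mem_span_singleton_self _)),
        Submodule.mem_span_singleton_self _⟩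

/-- A class of order two in the discriminant group of `Ω` which is not divisible by two. -/
def coeffIndivisible : Fin 15 → ℤ := ![1, 0, 1, 0, 0, 0, 0, 0, 0, 0, 0, 0, 0, 0, 0]

/-- A class of order two in the discriminant group of `Ω` which is divisible by two. -/
def coeffDivisible : Fin 15 → ℤ := ![1, -1, 0, 0, 0, 0, 0, 0, 0, 0, 0, 0, 1, 2, 0]

theorem exists_bil_comb_eq (d : ℤ) {c r : Fin 15 → ℤ} {a : ℤ} (h : c ᵥ* genGram = a • r)
    {ω : V} (hω : ω ∈ Ω) : ∃ n : ℤ, bil d (comb c) ω = a * n := by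
  obtain ⟨c', rfl⟩ := mem_Ω.1 hω
  refine ⟨r ⬝ᵥ c', ?_⟩
  rw [bil_comb, dotProduct_mulVec, h, smul_dotProduct, smul_eq_mul]
  push_cast
  rfl

theorem half_comb_notMem {c : Fin 15 → ℤ} {i : Fin 23}
    (h : Odd (∑ k, c k * tripleGen k i)) : (1 / 2 : ℚ) • comb c ∉ Ω := by
  intro hmem
  obtain ⟨c', hc'⟩ := mem_Ω.1 hmem
  have h2 : ((∑ k, c k * tripleGen k i : ℤ) : ℚ)
      = ((2 * ∑ k, c' k * tripleGen k i : ℤ) : ℚ) := by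
    rw [Int.cast_mul, ← three_mul_comb_apply, ← three_mul_comb_apply, hc', Pi.smul_apply,
      smul_eq_mul]
    push_cast
    ring
  rw [Int.cast_inj.1 h2] at h
  exact (Int.not_odd_iff_even.2 (even_two_mul _)) h

theorem coeffIndivisible_vecMul : coeffIndivisible ᵥ* genGram
    = (2 : ℤ) • ![-2, 1, -2, 1, 0, 0, 0, 0, 0, 0, 0, 0, -1, -1, -1] := by
  decide +kernel

theorem coeffDivisible_vecMul : coeffDivisible ᵥ* genGram
    = (4 : ℤ) • ![-2, 2, -1, 1, -1, 1, 0, 0, 1, 0, 0, 1, -2, -2, 0] := by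
  decide +kernel

theorem isAdmissible_overlattice_indivisible {d : ℤ} (h4 : 4 ∣ d) :
    IsAdmissible d (overlattice (comb coeffIndivisible)) := by
  refine isAdmissible_overlattice h4 (comb_mem _)
    (fun ω hω => exists_bil_comb_eq d coeffIndivisible_vecMul hω) ⟨-1, ?_⟩
    (half_comb_notMem (i := 16) (by decide +kernel))
  rw [bil_comb, show coeffIndivisible ⬝ᵥ (genGram *ᵥ coeffIndivisible) = -8 by decide +kernel]
  norm_num

theorem isAdmissible_overlattice_divisible {d : ℤ} (h4 : 4 ∣ d) :
    IsAdmissible d (overlattice (comb coeffDivisible)) := by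
  refine isAdmissible_overlattice h4 (comb_mem _) (fun ω hω => ?_) ⟨-5, ?_⟩
    (half_comb_notMem (i := 0) (by decide +kernel))
  · obtain ⟨n, hn⟩ := exists_bil_comb_eq d coeffDivisible_vecMul hω
    exact ⟨2 * n, by rw [hn]; push_cast; ring⟩
  · rw [bil_comb, show coeffDivisible ⬝ᵥ (genGram *ᵥ coeffDivisible) = -40 by decide +kernel]
    norm_num

/-- The Gram matrix modulo two of three orthogonal hyperbolic planes. -/
def threePlanes : Matrix (Fin 6) (Fin 6) (ZMod 2) :=
  !![0, 1, 0, 0, 0, 0;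
    1, 0, 0, 0, 0, 0;
    0, 0, 0, 1, 0, 0;
    0, 0, 1, 0, 0, 0;
    0, 0, 0, 0, 0, 1;
    0, 0, 0, 0, 1, 0]

theorem mul_ne_threePlanes (P : Matrix (Fin 6) (Fin 4) (ZMod 2))
    (Q : Matrix (Fin 4) (Fin 6) (ZMod 2)) : P * Q ≠ threePlanes := by
  intro h
  have h1 : P * (Q * threePlanes) = 1 := by
    rw [← Matrix.mul_assoc, h]
    decide +kernel
  have h2 := Matrix.rank_mul_le_left P (Q * threePlanes)
  rw [h1, Matrix.rank_one, Fintype.card_fin] at h2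
  have h3 := P.rank_le_width
  omega

/-- The Gram matrix of the generators of `Ω` has rank at most four modulo two. -/
theorem genGram_mod_two : genGram.map (Int.castRingHom (ZMod 2))
    = ((genGram.map (Int.castRingHom (ZMod 2))).submatrix id ![6, 10, 7, 9] :
        Matrix (Fin 15) (Fin 4) (ZMod 2))
      * ((genGram.map (Int.castRingHom (ZMod 2))).submatrix ![10, 6, 9, 7] id :
        Matrix (Fin 4) (Fin 15) (ZMod 2)) := by
  decide +kernel

theorem gram_overlattice_divisible_ne {d : ℤ} (h4 : 4 ∣ d) (y : Fin 6 → V)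
    (hy : ∀ k, y k ∈ overlattice (comb coeffDivisible)) (M : Matrix (Fin 6) (Fin 6) ℤ)
    (hM : ∀ k l, bil d (y k) (y l) = M k l) : M.map (Int.cast : ℤ → ZMod 2) ≠ threePlanes := by
  obtain ⟨e, rfl⟩ := h4
  have hrep : ∀ k, ∃ c : Fin 15 → ℤ, ∃ n : ℤ,
      comb c + n • glue (comb coeffDivisible) = y k := by
    intro k
    obtain ⟨ω, hω, n, h⟩ := mem_overlattice.1 (hy k)
    obtain ⟨c, rfl⟩ := mem_Ω.1 hω
    exact ⟨c, n, h⟩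
  choose c n hcn using hrep
  have hval : ∀ k l, ∃ t : ℤ, M k l = c k ⬝ᵥ (genGram *ᵥ c l) + 2 * t := by
    intro k l
    obtain ⟨a, ha⟩ := exists_bil_comb_eq (4 * e) coeffDivisible_vecMul (comb_mem (c k))
    obtain ⟨b, hb⟩ := exists_bil_comb_eq (4 * e) coeffDivisible_vecMul (comb_mem (c l))
    refine ⟨n l * a + n k * b + n k * n l * (-5 + e), ?_⟩
    have h := hM k l
    rw [← hcn, ← hcn, bil_add_zsmul_glue _ (comb_mem _) (comb_mem _) (comb_mem _), ha, hb,
      bil_comb, bil_comb,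
      show coeffDivisible ⬝ᵥ (genGram *ᵥ coeffDivisible) = -40 by decide +kernel] at h
    have h' : (M k l : ℚ) = ((c k ⬝ᵥ (genGram *ᵥ c l)
        + 2 * (n l * a + n k * b + n k * n l * (-5 + e)) : ℤ) : ℚ) := by
      rw [← h]
      push_cast
      ring
    exact_mod_cast h'
  let C : Matrix (Fin 6) (Fin 15) ℤ := Matrix.of c
  let f := Int.castRingHom (ZMod 2)
  have hfac : M.map (Int.cast : ℤ → ZMod 2) = C.map f * genGram.map f * Cᵀ.map f := by
    rw [← Matrix.map_mul, ← Matrix.map_mul]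
    ext k l
    obtain ⟨t, ht⟩ := hval k l
    have hent : (C * genGram * Cᵀ) k l = c k ⬝ᵥ (genGram *ᵥ c l) := by
      rw [Matrix.mul_assoc, Matrix.mul_apply']
      rfl
    rw [map_apply, map_apply, ht, hent, eq_intCast, Int.cast_add, Int.cast_mul,
      show ((2 : ℤ) : ZMod 2) = 0 from rfl, zero_mul, add_zero]
  rw [hfac, genGram_mod_two, ← Matrix.mul_assoc, Matrix.mul_assoc]
  exact mul_ne_threePlanes _ _

/-- Coefficients of five vectors of `Ω` which, followed by the glue vector, span three orthogonal
hyperbolic planes modulo two in the overlattice of the indivisible class. -/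
def planeCoeff : Fin 6 → Fin 15 → ℤ :=
  ![Pi.single 6 1, Pi.single 10 1, Pi.single 7 1, Pi.single 9 1, Pi.single 1 1, 0]

/-- The coefficient of the glue vector in each of the six vectors spanning the planes. -/
def planeGlue : Fin 6 → ℤ := ![0, 0, 0, 0, 0, 1]

theorem exists_gram_overlattice_indivisible {d : ℤ} (h4 : 4 ∣ d) :
    ∃ (x : Fin 6 → V) (M : Matrix (Fin 6) (Fin 6) ℤ),
      (∀ k, x k ∈ overlattice (comb coeffIndivisible)) ∧ (∀ k l, bil d (x k) (x l) = M k l) ∧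
      M.map (Int.cast : ℤ → ZMod 2) = threePlanes := by
  obtain ⟨e, rfl⟩ := h4
  let r : Fin 15 → ℤ := ![-2, 1, -2, 1, 0, 0, 0, 0, 0, 0, 0, 0, -1, -1, -1]
  let N : Matrix (Fin 6) (Fin 6) ℤ := Matrix.of fun k l =>
    planeCoeff k ⬝ᵥ (genGram *ᵥ planeCoeff l) + planeGlue l * (r ⬝ᵥ planeCoeff k)
      + planeGlue k * (r ⬝ᵥ planeCoeff l)
  refine ⟨fun k => comb (planeCoeff k) + planeGlue k • glue (comb coeffIndivisible),
    Matrix.of fun k l => N k l + 2 * (planeGlue k * planeGlue l * (e - 1)),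
    fun k => mem_overlattice.2 ⟨_, comb_mem _, _, rfl⟩, fun k l => ?_, ?_⟩
  · have hr : ∀ c, bil (4 * e) (comb coeffIndivisible) (comb c) = 2 * ((r ⬝ᵥ c : ℤ) : ℚ) := by
      intro c
      rw [bil_comb, dotProduct_mulVec, coeffIndivisible_vecMul, smul_dotProduct, smul_eq_mul]
      push_cast
      rfl
    rw [bil_add_zsmul_glue _ (comb_mem _) (comb_mem _) (comb_mem _), hr, hr, bil_comb, bil_comb,
      show coeffIndivisible ⬝ᵥ (genGram *ᵥ coeffIndivisible) = -8 by decide +kernel]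
    simp only [N, Matrix.of_apply]
    push_cast
    ring
  · have hN : N.map (Int.cast : ℤ → ZMod 2) = threePlanes := by decide +kernel
    rw [← hN]
    ext k l
    rw [map_apply, map_apply, Matrix.of_apply]
    push_cast
    rw [show (2 : ZMod 2) = 0 from rfl, zero_mul, add_zero]

/-- if d ≡ 0 (mod 4) there are two admissible even overlattices
of index 2 of S = Ω_{2,2} ⊕ ⟨2d⟩ which are not isometric. -/
theorem stmt9 (d : ℤ) (hd : 0 < d) (h4 : (4 : ℤ) ∣ d) :
    ∃ S1 S2 : Submodule ℤ V,
      IsAdmissible d S1 ∧ IsAdmissible d S2 ∧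
      idx S1 = 2 ∧ idx S2 = 2 ∧
      ¬ ∃ F : S1 ≃ₗ[ℤ] S2, ∀ u v : S1, B d (F u : V) (F v : V) = B d (u : V) (v : V) := by
  refine ⟨overlattice (comb coeffIndivisible), overlattice (comb coeffDivisible),
    isAdmissible_overlattice_indivisible h4, isAdmissible_overlattice_divisible h4,
    idx_overlattice (comb_mem _), idx_overlattice (comb_mem _), ?_⟩
  rintro ⟨F, hF⟩
  obtain ⟨x, M, hx, hM, hplanes⟩ := exists_gram_overlattice_indivisible h4
  refine gram_overlattice_divisible_ne h4 (fun k => (F ⟨x k, hx k⟩ : V)) (fun k => (F ⟨x k, hx k⟩).2) M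
    (fun k l => ?_) hplanes
  rw [← B_eq_bil, hF, B_eq_bil]
  exact hM k l
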